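/- Let G be a non-complete strictly chordal graph with τ(G) < 1 such that every minimal vertex separator S of G satisfies |S| ≥ μ(S) (a type A graph). Then every minimal vertex separator S of G with |S| = μ(S) is a scattering set of G, i.e., ω(G−S) − |S| = sc(G). -/

import Mathlib

open SimpleGraph

variable {V : Type*}

noncomputable def numComp (G : SimpleGraph V) (S : Set V) : ℕ :=
  Nat.card (G.induce Sᶜ).ConnectedComponent

def SeparatedBy (G : SimpleGraph V) (S : Set V) (u v : V) : Prop :=
  ∃ (hu : u ∈ Sᶜ) (hv : v ∈ Sᶜ), ¬ (G.induce Sᶜ).Reachable ⟨u, hu⟩ ⟨v, hv⟩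

def IsSeparator (G : SimpleGraph V) (S : Set V) : Prop :=
  ∃ u v, G.Reachable u v ∧ SeparatedBy G S u v

def IsMinimalSeparator (G : SimpleGraph V) (S : Set V) : Prop :=
  IsSeparator G S ∧ ∀ T ⊂ S, ¬ IsSeparator G T

def IsMVS (G : SimpleGraph V) (S : Set V) : Prop :=
  ∃ u v, u ≠ v ∧ ¬ G.Adj u v ∧ SeparatedBy G S u v ∧ ∀ T ⊂ S, ¬ SeparatedBy G T u v

def IsChordal (G : SimpleGraph V) : Prop :=
  ∀ n, 4 ≤ n → IsEmpty (cycleGraph n ↪g G)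

def StrictlyChordal (G : SimpleGraph V) : Prop :=
  G.Connected ∧ IsChordal G ∧
    ∀ S S' : Set V, IsMVS G S → IsMVS G S' → S ≠ S' → Disjoint S S'

noncomputable def sc [Finite V] (G : SimpleGraph V) : ℤ :=
  sSup {k : ℤ | ∃ S : Set V, numComp G S ≠ 1 ∧ k = (numComp G S : ℤ) - (Nat.card S : ℤ)}

noncomputable def toughness [Finite V] (G : SimpleGraph V) : ℝ :=
  sInf {t : ℝ | ∃ S : Set V, 1 < numComp G S ∧ t = (Nat.card S : ℝ) / (numComp G S : ℝ)}

def IsScatteringSet [Finite V] (G : SimpleGraph V) (S : Set V) : Prop :=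
  numComp G S ≠ 1 ∧ (numComp G S : ℤ) - (Nat.card S : ℤ) = sc G

def IsMaxClique (G : SimpleGraph V) (Q : Set V) : Prop :=
  G.IsClique Q ∧ ∀ R : Set V, G.IsClique R → Q ⊆ R → Q = R

def IsSimplicial (G : SimpleGraph V) (v : V) : Prop :=
  G.IsClique (G.neighborSet v)

def IsBoundaryClique (G : SimpleGraph V) (Q : Set V) : Prop :=
  IsMaxClique G Q ∧ (∃ v ∈ Q, IsSimplicial G v) ∧
    ∃ Q' : Set V, IsMaxClique G Q' ∧ Q' ≠ Q ∧ Q ∩ Q' = {v | v ∈ Q ∧ ¬ IsSimplicial G v}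

def BS (G : SimpleGraph V) (S : Set V) : Set (Set V) :=
  {Q | IsBoundaryClique G Q ∧ S ⊆ Q}

/-- `x` and `y` lie in the same component of `G - T`. -/
def LinkedOff (G : SimpleGraph V) (T : Set V) (x y : V) : Prop :=
  ∃ (hx : x ∈ Tᶜ) (hy : y ∈ Tᶜ), (G.induce Tᶜ).Reachable ⟨x, hx⟩ ⟨y, hy⟩

namespace LinkedOff

variable {G : SimpleGraph V} {S T : Set V} {x y z : V}

theorem notMem_left (h : LinkedOff G T x y) : x ∉ T := h.1

theorem notMem_right (h : LinkedOff G T x y) : y ∉ T := h.2.1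

theorem refl (hx : x ∉ T) : LinkedOff G T x x := ⟨hx, hx, Reachable.refl _⟩

theorem symm (h : LinkedOff G T x y) : LinkedOff G T y x :=
  ⟨h.2.1, h.1, h.2.2.symm⟩

theorem trans (h : LinkedOff G T x y) (h' : LinkedOff G T y z) : LinkedOff G T x z :=
  ⟨h.1, h'.2.1, h.2.2.trans h'.2.2⟩

theorem of_adj (h : G.Adj x y) (hx : x ∉ T) (hy : y ∉ T) : LinkedOff G T x y :=
  ⟨hx, hy, Adj.reachable (G := G.induce Tᶜ) (u := ⟨x, hx⟩) (v := ⟨y, hy⟩) h⟩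

theorem induction {P : V → Prop} (h : LinkedOff G T x y) (hx : P x)
    (step : ∀ p q, LinkedOff G T x p → P p → G.Adj p q → q ∉ T → P q) : P y := by
  obtain ⟨hxT, hyT, ⟨w⟩⟩ := h
  have key : ∀ (p q : ↥Tᶜ) (w : (G.induce Tᶜ).Walk p q),
      LinkedOff G T x p → P p → P q := by
    intro p q w
    induction w with
    | nil => exact fun _ hp => hp
    | @cons p q r hpq w ih =>
      intro hxp hp
      exact ih (hxp.trans (of_adj hpq p.2 q.2)) (step p q hxp hp hpq q.2)
  exact key _ _ w (refl hxT) hx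

theorem of_forall (h : LinkedOff G S x y) (hT : ∀ z, LinkedOff G S x z → z ∉ T) :
    LinkedOff G T x y := by
  refine h.induction (refl (hT x (refl h.notMem_left))) fun p q hxp hp hpq hq => ?_
  exact hp.trans (of_adj hpq hp.notMem_right (hT q (hxp.trans (of_adj hpq hxp.notMem_right hq))))

theorem mono (h : LinkedOff G T x y) (hST : S ⊆ T) : LinkedOff G S x y :=
  h.of_forall fun _ hz hzS => hz.notMem_right (hST hzS)

end LinkedOff

theorem separatedBy_iff {G : SimpleGraph V} {T : Set V} {x y : V} :
    SeparatedBy G T x y ↔ x ∉ T ∧ y ∉ T ∧ ¬ LinkedOff G T x y := by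
  constructor
  · rintro ⟨hx, hy, h⟩
    exact ⟨hx, hy, fun ⟨_, _, h'⟩ => h h'⟩
  · rintro ⟨hx, hy, h⟩
    exact ⟨hx, hy, fun h' => h ⟨hx, hy, h'⟩⟩

theorem SeparatedBy.symm {G : SimpleGraph V} {T : Set V} {x y : V} (h : SeparatedBy G T x y) :
    SeparatedBy G T y x := by
  rw [separatedBy_iff] at h ⊢
  exact ⟨h.2.1, h.1, fun h' => h.2.2 h'.symm⟩

theorem SeparatedBy.ne {G : SimpleGraph V} {T : Set V} {x y : V} (h : SeparatedBy G T x y) :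
    x ≠ y := by
  rw [separatedBy_iff] at h
  rintro rfl
  exact h.2.2 (.refl h.1)

theorem SeparatedBy.not_adj {G : SimpleGraph V} {T : Set V} {x y : V} (h : SeparatedBy G T x y) :
    ¬ G.Adj x y := by
  rw [separatedBy_iff] at h
  exact fun h' => h.2.2 (.of_adj h' h.1 h.2.1)

theorem separatedBy_neighborSet {G : SimpleGraph V} {x y : V} (hne : x ≠ y) (h : ¬ G.Adj x y) :
    SeparatedBy G (G.neighborSet x) x y := by
  refine separatedBy_iff.2 ⟨by simp, h, fun hl => hne ?_⟩
  refine hl.induction (P := fun z => x = z) rfl ?_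
  rintro p q - rfl hpq hq
  exact absurd hpq hq

/-- Every common neighbour of two separated vertices lies in the separator. -/
theorem SeparatedBy.mem_of_adj {G : SimpleGraph V} {T : Set V} {x y z : V}
    (h : SeparatedBy G T x y) (hx : G.Adj x z) (hy : G.Adj y z) : z ∈ T := by
  rw [separatedBy_iff] at h
  by_contra hz
  exact h.2.2 ((LinkedOff.of_adj hx h.1 hz).trans (.of_adj hy.symm hz h.2.1))

theorem SeparatedBy.exists_isMVS_subset [Finite V] {G : SimpleGraph V} {T : Set V} {x y : V}
    (h : SeparatedBy G T x y) : ∃ R ⊆ T, IsMVS G R ∧ SeparatedBy G R x y := by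
  obtain ⟨R, hRT, hR⟩ := (Set.toFinite {R | SeparatedBy G R x y}).exists_le_minimal h
  exact ⟨R, hRT, ⟨x, y, h.ne, h.not_adj, hR.prop,
    fun U hU hUs => hU.not_subset (hR.le_of_le hUs hU.subset)⟩, hR.prop⟩

/-- Each vertex of a minimal `uv`-separator has a neighbour in the component of `u`. -/
theorem SeparatedBy.exists_adj_linkedOff {G : SimpleGraph V} {S : Set V} {u v a : V}
    (h : SeparatedBy G S u v) (hmin : ∀ T ⊂ S, ¬ SeparatedBy G T u v) (ha : a ∈ S) :
    ∃ p, LinkedOff G S u p ∧ G.Adj p a := by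
  rw [separatedBy_iff] at h
  obtain ⟨hu, hv, hn⟩ := h
  have hl : LinkedOff G (S \ {a}) u v := by
    by_contra hl
    exact hmin (S \ {a}) (Set.sdiff_singleton_ssubset.2 ha)
      (separatedBy_iff.2 ⟨fun h => hu h.1, fun h => hv h.1, hl⟩)
  by_contra! hc
  refine hn (hl.induction (.refl hu) fun p q _ hp hpq hq => ?_)
  by_cases hqS : q ∈ S
  · have hqa : q = a := by
      by_contra hqa
      exact hq ⟨hqS, hqa⟩
    exact absurd (hqa ▸ hpq) (hc p hp)
  · exact hp.trans (.of_adj hpq hp.notMem_right hqS)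

/-- A separator of two vertices of a minimal `uv`-separator `S` meets the component of `u`
in `G - S`. -/
theorem SeparatedBy.exists_mem_linkedOff {G : SimpleGraph V} {S R : Set V} {u v a b : V}
    (h : SeparatedBy G S u v) (hmin : ∀ T ⊂ S, ¬ SeparatedBy G T u v) (ha : a ∈ S) (hb : b ∈ S)
    (hR : SeparatedBy G R a b) : ∃ c ∈ R, LinkedOff G S u c := by
  obtain ⟨p, hp, hpa⟩ := h.exists_adj_linkedOff hmin ha
  obtain ⟨q, hq, hqb⟩ := h.exists_adj_linkedOff hmin hb
  obtain ⟨haR, hbR, hn⟩ := separatedBy_iff.1 hR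
  by_contra! hc
  have hpq : LinkedOff G R p q :=
    (hp.symm.trans hq).of_forall fun z hz hzR => hc z hzR (hp.trans hz)
  exact hn (((LinkedOff.of_adj hpa hpq.notMem_left haR).symm.trans hpq).trans
    (.of_adj hqb hpq.notMem_right hbR))

theorem IsChordal.adj_of_four_cycle {G : SimpleGraph V} (hG : IsChordal G) {a c b d : V}
    (hac : G.Adj a c) (hcb : G.Adj c b) (hbd : G.Adj b d) (hda : G.Adj d a)
    (hab : a ≠ b) (hcd : c ≠ d) : G.Adj a b ∨ G.Adj c d := by
  by_contra! hn
  have hba : ¬ G.Adj b a := fun h => hn.1 h.symm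
  have hdc : ¬ G.Adj d c := fun h => hn.2 h.symm
  refine (hG 4 le_rfl).false ⟨⟨![a, c, b, d], ?_⟩, ?_⟩
  · intro i j hij
    fin_cases i <;> fin_cases j <;>
      simp_all [hac.ne, hac.ne', hcb.ne, hcb.ne', hbd.ne, hbd.ne', hda.ne, hda.ne', hab.symm,
        hcd.symm]
  · intro i j
    change G.Adj (![a, c, b, d] i) (![a, c, b, d] j) ↔ (cycleGraph 4).Adj i j
    have hcyc : (cycleGraph 4).Adj i j ↔ i - j = 1 ∨ j - i = 1 := cycleGraph_adj
    rw [hcyc]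
    fin_cases i <;> fin_cases j <;>
      simp [hac, hac.symm, hcb, hcb.symm, hbd, hbd.symm, hda, hda.symm, hn.1, hn.2, hba, hdc] <;>
      decide

theorem StrictlyChordal.isClique_of_isMVS [Finite V] {G : SimpleGraph V} (hG : StrictlyChordal G)
    {S : Set V} (hS : IsMVS G S) : G.IsClique S := by
  intro a ha b hb hab
  by_contra hnab
  obtain ⟨u, v, -, -, hsep, hmin⟩ := id hS
  obtain ⟨R, hRN, -, hR⟩ := (separatedBy_neighborSet hab hnab).exists_isMVS_subset
  obtain ⟨c, hcR, hc⟩ := hsep.exists_mem_linkedOff hmin ha hb hR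
  obtain ⟨d, hdR, hd⟩ := hsep.symm.exists_mem_linkedOff (fun T hT h => hmin T hT h.symm) ha hb hR
  have hcd : SeparatedBy G S c d := separatedBy_iff.2 ⟨hc.notMem_right, hd.notMem_right,
    fun h => (separatedBy_iff.1 hsep).2.2 ((hc.trans h).trans hd.symm)⟩
  have hac : G.Adj a c := hRN hcR
  have had : G.Adj a d := hRN hdR
  have hsub : ∀ x y, G.Adj x a → G.Adj y a → SeparatedBy G S x y → S ⊆ G.neighborSet x := by
    intro x y hx hy hxy
    obtain ⟨Q, hQN, hQ, hQs⟩ := (separatedBy_neighborSet hxy.ne hxy.not_adj).exists_isMVS_subset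
    by_cases hQS : Q = S
    · exact hQS ▸ hQN
    · exact absurd ha (Set.disjoint_left.1 (hG.2.2 Q S hQ hS hQS) (hQs.mem_of_adj hx hy))
  rcases hG.2.1.adj_of_four_cycle hac (hsub c d hac.symm had.symm hcd hb)
    (hsub d c had.symm hac.symm hcd.symm hb).symm had.symm hab hcd.ne with h | h
  exacts [hnab h, hcd.not_adj h]

/-- In a strictly chordal graph, removing a minimal separator and a further disjoint set splits
only what one of the two sets already splits. -/
theorem StrictlyChordal.linkedOff_union [Finite V] {G : SimpleGraph V} (hG : StrictlyChordal G)
    {S T : Set V} (hS : IsMVS G S) {x y : V} (hxS : LinkedOff G S x y) (hxT : LinkedOff G T x y) :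
    LinkedOff G (S ∪ T) x y := by
  by_contra hn
  have hsep : SeparatedBy G (S ∪ T) x y := separatedBy_iff.2
    ⟨fun h => h.elim hxS.notMem_left hxT.notMem_left,
      fun h => h.elim hxS.notMem_right hxT.notMem_right, hn⟩
  obtain ⟨R, hRST, hR, hRs⟩ := hsep.exists_isMVS_subset
  have hRn := (separatedBy_iff.1 hRs).2.2
  by_cases hRS : R = S
  · exact hRn (hRS ▸ hxS)
  · exact hRn (hxT.mono ((hG.2.2 R S hR hS hRS).subset_right_of_subset_union hRST))

theorem linkedOff_iff_mk_eq {G : SimpleGraph V} {T : Set V} {x y : V} (hx : x ∈ Tᶜ) (hy : y ∈ Tᶜ) :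
    LinkedOff G T x y ↔ (G.induce Tᶜ).connectedComponentMk ⟨x, hx⟩ =
      (G.induce Tᶜ).connectedComponentMk ⟨y, hy⟩ := by
  rw [ConnectedComponent.eq]
  exact ⟨fun h => h.2.2, fun h => ⟨hx, hy, h⟩⟩

theorem StrictlyChordal.numComp_union_lt [Finite V] {G : SimpleGraph V} (hG : StrictlyChordal G)
    {S T : Set V} (hS : IsMVS G S) (hne : S.Nonempty) (hd : Disjoint S T) :
    numComp G (S ∪ T) < numComp G S + numComp G T := by
  classical
  obtain ⟨s, hs⟩ := hne
  have hsT : s ∈ Tᶜ := Set.disjoint_left.1 hd hs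
  have hST : ∀ z ∈ S, LinkedOff G T s z := by
    intro z hz
    by_cases hsz : s = z
    · exact hsz ▸ .refl hsT
    · exact .of_adj (hG.isClique_of_isMVS hS hs hz hsz) hsT (Set.disjoint_left.1 hd hz)
  let C := (G.induce Tᶜ).connectedComponentMk ⟨s, hsT⟩
  let cS : ↥(S ∪ T)ᶜ → (G.induce Sᶜ).ConnectedComponent := fun x =>
    (G.induce Sᶜ).connectedComponentMk ⟨x, fun h => x.2 (Or.inl h)⟩
  let cT : ↥(S ∪ T)ᶜ → (G.induce Tᶜ).ConnectedComponent := fun x =>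
    (G.induce Tᶜ).connectedComponentMk ⟨x, fun h => x.2 (Or.inr h)⟩
  let f : ↥(S ∪ T)ᶜ → (G.induce Sᶜ).ConnectedComponent ⊕
      {D : (G.induce Tᶜ).ConnectedComponent // D ≠ C} := fun x =>
    if h : cT x = C then .inl (cS x) else .inr ⟨cT x, h⟩
  have hf : ∀ x y, f x = f y → LinkedOff G (S ∪ T) x y := by
    intro x y hxy
    by_cases hx : cT x = C <;> by_cases hy : cT y = C <;> simp [f, hx, hy] at hxy
    · exact hG.linkedOff_union hS ((linkedOff_iff_mk_eq _ _).2 hxy)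
        ((linkedOff_iff_mk_eq _ _).2 (hx.trans hy.symm))
    · refine ((linkedOff_iff_mk_eq _ _).2 hxy : LinkedOff G T x y).of_forall ?_
      rintro z hz (hzS | hzT)
      · exact hx ((linkedOff_iff_mk_eq _ _).1 (hz.trans (hST z hzS).symm))
      · exact hz.notMem_right hzT
  have hinj : Function.Injective fun K : (G.induce (S ∪ T)ᶜ).ConnectedComponent =>
      f K.out := by
    intro K L hKL
    have := (linkedOff_iff_mk_eq K.out.2 L.out.2).1 (hf _ _ hKL)
    rwa [show (G.induce (S ∪ T)ᶜ).connectedComponentMk ⟨K.out, K.out.2⟩ = K from Quot.out_eq K,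
      show (G.induce (S ∪ T)ᶜ).connectedComponentMk ⟨L.out, L.out.2⟩ = L from Quot.out_eq L] at this
  have hcard := Nat.card_le_card_of_injective _ hinj
  rw [Nat.card_sum] at hcard
  have hlt : Nat.card {D : (G.induce Tᶜ).ConnectedComponent // D ≠ C} <
      Nat.card (G.induce Tᶜ).ConnectedComponent :=
    Finite.card_subtype_lt (x := C) (by simp)
  unfold numComp
  omega

theorem StrictlyChordal.nonempty_of_isMVS {G : SimpleGraph V} (hG : StrictlyChordal G)
    {S : Set V} (hS : IsMVS G S) : S.Nonempty := by
  obtain ⟨u, v, -, -, hsep, -⟩ := hS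
  by_contra hn
  rw [Set.not_nonempty_iff_eq_empty] at hn
  subst hn
  refine (separatedBy_iff.1 hsep).2.2 ?_
  obtain ⟨w⟩ := hG.1.preconnected u v
  clear hsep
  induction w with
  | nil => exact .refl (Set.notMem_empty _)
  | cons h _ ih => exact (LinkedOff.of_adj h (Set.notMem_empty _) (Set.notMem_empty _)).trans ih

theorem exists_separatedBy_of_one_lt_numComp [Finite V] {G : SimpleGraph V} {T : Set V}
    (h : 1 < numComp G T) : ∃ x y, SeparatedBy G T x y := by
  obtain ⟨K, L, hKL⟩ := (Finite.one_lt_card_iff_nontrivial.1 h).exists_pair_ne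
  induction K using ConnectedComponent.ind with | _ x
  induction L using ConnectedComponent.ind with | _ y
  exact ⟨x, y, x.2, y.2, fun h => hKL (ConnectedComponent.eq.2 h)⟩

theorem StrictlyChordal.numComp_le [Finite V] {G : SimpleGraph V} (hG : StrictlyChordal G)
    (hA : ∀ S : Set V, IsMVS G S → numComp G S ≤ Nat.card S + 1) (T : Set V) :
    numComp G T ≤ Nat.card T + 1 := by
  simp only [Nat.card_coe_set_eq] at hA ⊢
  induction hn : T.ncard using Nat.strong_induction_on generalizing T with
  | _ n ih =>
    subst hn
    rcases Nat.lt_or_ge 1 (numComp G T) with h | h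
    · obtain ⟨x, y, hxy⟩ := exists_separatedBy_of_one_lt_numComp h
      obtain ⟨S, hST, hS, -⟩ := hxy.exists_isMVS_subset
      have hne := hG.nonempty_of_isMVS hS
      have hlt := hG.numComp_union_lt hS hne (T := T \ S) Set.disjoint_sdiff_right
      rw [Set.union_sdiff_cancel hST] at hlt
      have hcard := Set.ncard_sdiff_add_ncard_of_subset hST
      have hpos := hne.ncard_pos
      have := ih _ (by omega) (T \ S) rfl
      have := hA S hS
      omega
    · omega

theorem statement13 {V : Type*} [Finite V] (G : SimpleGraph V)
    (hsc : StrictlyChordal G) (hnc : G ≠ ⊤) (ht : toughness G < 1)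
    (hA : ∀ S : Set V, IsMVS G S → numComp G S ≤ Nat.card S + 1) :
    ∀ S : Set V, IsMVS G S → Nat.card S + 1 = numComp G S →
      IsScatteringSet G S := by
  intro S hS hcard
  have := (hsc.nonempty_of_isMVS hS).to_subtype
  have hpos : 0 < Nat.card S := Nat.card_pos
  have hne : numComp G S ≠ 1 := by omega
  have hgr : IsGreatest {k : ℤ | ∃ S : Set V, numComp G S ≠ 1 ∧
      k = (numComp G S : ℤ) - (Nat.card S : ℤ)} ((numComp G S : ℤ) - (Nat.card S : ℤ)) := by
    refine ⟨⟨S, hne, rfl⟩, ?_⟩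
    rintro _ ⟨T, -, rfl⟩
    have := hsc.numComp_le hA T
    omega
  exact ⟨hne, hgr.csSup_eq.symm⟩
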